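/- Let m ≥ 9 and n ≥ m² − m + 1 be integers, let T be a tree on n vertices, and let G be a graph on 2n − 1 vertices that does not contain the fan F_m as a subgraph and whose complement does not contain T as a subgraph. Then every vertex of T is adjacent in T to at most m − 2 leaves of T, and the maximum degree of T satisfies Δ(T) < 11n/20. -/

import Mathlib

open Finset

/-- `Contains G H` means `G` contains a subgraph isomorphic to `H`, i.e. there is an
injective map on vertices preserving adjacency. -/
def Contains {α β : Type*} (G : SimpleGraph α) (H : SimpleGraph β) : Prop :=
  ∃ f : β → α, Function.Injective f ∧ ∀ ⦃u v⦄, H.Adj u v → G.Adj (f u) (f v)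

/-- The fan `F_m = K_1 + mK_2`: a center vertex joined to `m` disjoint edges,
so `m` triangles sharing exactly one common vertex; it has `2m + 1` vertices. -/
def fan (m : ℕ) : SimpleGraph (Unit ⊕ Fin m × Bool) :=
  SimpleGraph.fromRel (fun x y =>
    (∃ u, x = Sum.inl u) ∨ ∃ i : Fin m, x = Sum.inr (i, true) ∧ y = Sum.inr (i, false))

/-- `G` has a matching of size `k` inside `S`. -/
def HM {W : Type*} (G : SimpleGraph W) (k : ℕ) (S : Finset W) : Prop :=
  ∃ a b : Fin k → W, Function.Injective a ∧ Function.Injective b ∧ (∀ i j, a i ≠ b j) ∧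
    (∀ i, a i ∈ S) ∧ (∀ i, b i ∈ S) ∧ ∀ i, G.Adj (a i) (b i)

lemma HM.of_fintype {W ι : Type*} [Fintype ι] {G : SimpleGraph W} {k : ℕ} {S : Finset W}
    (hk : Fintype.card ι = k) (a b : ι → W) (ha : Function.Injective a)
    (hb : Function.Injective b) (hab : ∀ i j, a i ≠ b j) (haS : ∀ i, a i ∈ S)
    (hbS : ∀ i, b i ∈ S) (hadj : ∀ i, G.Adj (a i) (b i)) : HM G k S := by
  let e : Fin k ≃ ι := (Fintype.equivFinOfCardEq hk).symm
  exact ⟨a ∘ e, b ∘ e, ha.comp e.injective, hb.comp e.injective, fun i j => hab _ _,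
    fun i => haS _, fun i => hbS _, fun i => hadj _⟩

lemma HM.mono {W : Type*} {G : SimpleGraph W} {k : ℕ} {S S' : Finset W} (h : HM G k S)
    (hS : S ⊆ S') : HM G k S' := by
  obtain ⟨a, b, h1, h2, h3, h4, h5, h6⟩ := h
  exact ⟨a, b, h1, h2, h3, fun i => hS (h4 i), fun i => hS (h5 i), h6⟩

lemma HM.zero {W : Type*} (G : SimpleGraph W) (S : Finset W) : HM G 0 S :=
  ⟨Fin.elim0, Fin.elim0, fun i => i.elim0, fun i => i.elim0, fun i => i.elim0, fun i => i.elim0,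
    fun i => i.elim0, fun i => i.elim0⟩

lemma HM.succ {W : Type*} [DecidableEq W] {G : SimpleGraph W} {k : ℕ} {S : Finset W} {x y : W}
    (hx : x ∈ S) (hy : y ∈ S) (hxy : G.Adj x y) (h : HM G k ((S.erase x).erase y)) :
    HM G (k + 1) S := by
  obtain ⟨a, b, h1, h2, h3, h4, h5, h6⟩ := h
  have hne := hxy.ne
  simp only [Finset.mem_erase] at h4 h5
  refine HM.of_fintype (ι := Option (Fin k)) (by simp) (fun o => o.elim x a)
    (fun o => o.elim y b) ?_ ?_ ?_ ?_ ?_ ?_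
  · rintro (_ | i) (_ | j) hij
    · rfl
    · exact absurd hij.symm (h4 j).2.1
    · exact absurd hij (h4 i).2.1
    · exact congrArg some (h1 hij)
  · rintro (_ | i) (_ | j) hij
    · rfl
    · exact absurd hij.symm (h5 j).1
    · exact absurd hij (h5 i).1
    · exact congrArg some (h2 hij)
  · rintro (_ | i) (_ | j)
    · exact hne
    · exact fun h => (h5 j).2.1 h.symm
    · exact (h4 i).1
    · exact h3 i j
  · rintro (_ | i)
    · exact hx
    · exact (h4 i).2.2
  · rintro (_ | i)
    · exact hy
    · exact (h5 i).2.2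
  · rintro (_ | i)
    · exact hxy
    · exact h6 i

lemma HM.exists_sub {W : Type*} [DecidableEq W] {G : SimpleGraph W} {k : ℕ} {S : Finset W}
    (h : HM G k S) : ∃ U ⊆ S, U.card = 2 * k ∧ HM G k U := by
  obtain ⟨a, b, h1, h2, h3, h4, h5, h6⟩ := h
  refine ⟨univ.image a ∪ univ.image b, ?_, ?_, a, b, h1, h2, h3, by simp, by simp, h6⟩
  · intro x; simp only [mem_union, mem_image, mem_univ, true_and]
    rintro (⟨i, rfl⟩ | ⟨i, rfl⟩)
    exacts [h4 i, h5 i]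
  · rw [card_union_of_disjoint, card_image_of_injective _ h1, card_image_of_injective _ h2]
    · simp; omega
    · rw [disjoint_left]; simp only [mem_image, mem_univ, true_and]
      rintro _ ⟨i, rfl⟩ ⟨j, hj⟩
      exact h3 i j hj.symm

/-- Greedy extension of a matching. -/
lemma HM.greedy {W : Type*} [DecidableEq W] {G : SimpleGraph W} [DecidableRel G.Adj] (k i : ℕ) :
    ∀ (S D U : Finset W), D ⊆ S → U ⊆ S → D.card = i → HM G k U → Disjoint D U →
      (∀ d ∈ D, i ≤ (((S \ D) \ U).filter (fun y => G.Adj d y)).card) → HM G (k + i) S := by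
  induction i with
  | zero => intro S D U _ hU _ h _ _; exact h.mono hU
  | succ i ih =>
    intro S D U hD hU hc h hdis hdeg
    obtain ⟨d, hd⟩ : D.Nonempty := by rw [← card_pos]; omega
    have h1 := hdeg d hd
    obtain ⟨y, hy⟩ : (((S \ D) \ U).filter (fun y => G.Adj d y)).Nonempty := by
      rw [← card_pos]; omega
    simp only [mem_filter, mem_sdiff] at hy
    obtain ⟨⟨⟨hyS, hyD⟩, hyU⟩, hdy⟩ := hy
    have hdU : d ∉ U := disjoint_left.1 hdis hd
    refine HM.succ (hD hd) hyS hdy (ih _ (D.erase d) U ?_ ?_ ?_ h ?_ ?_)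
    · intro z hz; simp only [mem_erase] at hz ⊢
      exact ⟨fun h => hyD (h ▸ hz.2), hz.1, hD hz.2⟩
    · intro z hz; simp only [mem_erase]
      exact ⟨fun h => hyU (h ▸ hz), fun h => hdU (h ▸ hz), hU hz⟩
    · rw [card_erase_of_mem hd]; omega
    · exact hdis.mono_left (erase_subset _ _)
    · intro d' hd'
      have h2 := hdeg d' (mem_of_mem_erase hd')
      have h3 : (((S \ D) \ U).filter (fun z => G.Adj d' z)).erase y ⊆
          (((((S.erase d).erase y) \ (D.erase d)) \ U).filter (fun z => G.Adj d' z)) := by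
        intro z; simp only [mem_filter, mem_sdiff, mem_erase]
        rintro ⟨h0, ⟨⟨h1, h2⟩, h3⟩, h4⟩
        exact ⟨⟨⟨⟨h0, fun h => h2 (h ▸ hd), h1⟩, fun h => h2 h.2⟩, h3⟩, h4⟩
      have h4 := card_le_card h3
      have h5 := Finset.pred_card_le_card_erase (s := ((S \ D) \ U).filter (fun z => G.Adj d' z)) (a := y)
      omega

/-- simple greedy version -/
lemma HM.greedy' {W : Type*} [DecidableEq W] {G : SimpleGraph W} [DecidableRel G.Adj] (m : ℕ)
    (S D Q : Finset W) (hD : D ⊆ S) (hQ : Q ⊆ S) (hc : D.card = m) (hdis : Disjoint D Q)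
    (hdeg : ∀ d ∈ D, m ≤ (Q.filter (fun y => G.Adj d y)).card) : HM G m S := by
  have := HM.greedy (G := G) 0 m S D ∅ hD (by simp) hc (HM.zero _ _) (by simp) (by
    intro d hd
    refine (hdeg d hd).trans (card_le_card (filter_subset_filter _ ?_))
    intro z hz
    simp only [mem_sdiff]
    exact ⟨⟨hQ hz, fun h => disjoint_left.1 hdis h hz⟩, by simp⟩)
  simpa using this

/-- Structure of a set without a matching of size `m`. -/
lemma HM.decomp {W : Type*} [DecidableEq W] {G : SimpleGraph W} {m : ℕ} {S : Finset W}
    (h : ¬ HM G m S) : ∃ k < m, ∃ a b : Fin k → W, ∃ R : Finset W,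
      Function.Injective a ∧ Function.Injective b ∧ (∀ i, a i ∈ S) ∧ (∀ i, b i ∈ S) ∧
      (∀ i, a i ∉ R) ∧ (∀ i, b i ∉ R) ∧ R ⊆ S ∧
      (∀ x ∈ S, x ∈ R ∨ (∃ i, x = a i) ∨ ∃ i, x = b i) ∧ R.card + 2 * k = S.card ∧
      (∀ i, G.Adj (a i) (b i)) ∧ (∀ x ∈ R, ∀ y ∈ R, ¬ G.Adj x y) ∧
      (∀ i, ∀ x ∈ R, ∀ y ∈ R, G.Adj (a i) x → G.Adj (b i) y → x = y) ∧
      (∀ i, ∀ x ∈ R, ∀ y ∈ R, G.Adj (a i) x → G.Adj (a i) y → x = y) := by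
  classical
  have hex : ∃ j, ¬ HM G j S := ⟨m, h⟩
  have hpos : Nat.find hex ≠ 0 := fun h0 => Nat.find_spec hex (h0 ▸ HM.zero G S)
  obtain ⟨k, hk⟩ := Nat.exists_eq_succ_of_ne_zero hpos
  have hno : ¬ HM G (k + 1) S := by have := Nat.find_spec hex; rwa [hk] at this
  have hyes : HM G k S := not_not.1 (Nat.find_min hex (m := k) (by omega))
  have hkm : k < m := by have := Nat.find_min' hex h; omega
  obtain ⟨a, b, h1, h2, h3, h4, h5, h6⟩ := hyes
  set R := S \ (univ.image a ∪ univ.image b) with hR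
  have hRmem : ∀ x, x ∈ R ↔ x ∈ S ∧ (∀ i, a i ≠ x) ∧ (∀ i, b i ≠ x) := by
    intro x; simp [hR, mem_sdiff]
  have hRc : R.card + 2 * k = S.card := by
    have hsub : univ.image a ∪ univ.image b ⊆ S := by
      intro x; simp only [mem_union, mem_image, mem_univ, true_and]
      rintro (⟨i, rfl⟩ | ⟨i, rfl⟩)
      exacts [h4 i, h5 i]
    have hc : (univ.image a ∪ univ.image b).card = 2 * k := by
      rw [card_union_of_disjoint, card_image_of_injective _ h1, card_image_of_injective _ h2]
      · simp; omega
      · rw [disjoint_left]; simp only [mem_image, mem_univ, true_and]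
        rintro _ ⟨i, rfl⟩ ⟨j, hj⟩
        exact h3 i j hj.symm
    rw [hR, card_sdiff_of_subset hsub, hc]
    have := card_le_card hsub
    omega
  have hind : ∀ x ∈ R, ∀ y ∈ R, ¬ G.Adj x y := by
    intro x hx y hy hxy
    rw [hRmem] at hx hy
    refine hno (HM.succ hx.1 hy.1 hxy ⟨a, b, h1, h2, h3, ?_, ?_, h6⟩)
    · intro i; simp only [mem_erase]; exact ⟨hy.2.1 i, hx.2.1 i, h4 i⟩
    · intro i; simp only [mem_erase]; exact ⟨hy.2.2 i, hx.2.2 i, h5 i⟩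
  have haug : ∀ i, ∀ x ∈ R, ∀ y ∈ R, G.Adj (a i) x → G.Adj (b i) y → x = y := by
    intro i x hx y hy hax hby
    by_contra hxy
    rw [hRmem] at hx hy
    refine hno (HM.of_fintype (ι := Option (Fin k)) (by simp) (fun o => o.elim (b i) a)
      (fun o => o.elim y (Function.update b i x)) ?_ ?_ ?_ ?_ ?_ ?_)
    · rintro (_ | j) (_ | l) hij
      · rfl
      · exact absurd hij.symm (h3 _ _)
      · exact absurd hij (h3 _ _)
      · exact congrArg some (h1 hij)
    · rintro (_ | j) (_ | l) hij
      · rfl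
      · simp only [Option.elim, Function.update_apply] at hij
        split_ifs at hij with hl
        · exact absurd hij.symm hxy
        · exact absurd hij.symm (hy.2.2 l)
      · simp only [Option.elim, Function.update_apply] at hij
        split_ifs at hij with hl
        · exact absurd hij hxy
        · exact absurd hij (hy.2.2 j)
      · simp only [Option.elim, Function.update_apply] at hij
        split_ifs at hij with hj hl hl
        · rw [hj, hl]
        · exact absurd hij.symm (hx.2.2 l)
        · exact absurd hij (hx.2.2 j)
        · exact congrArg some (h2 hij)
    · rintro (_ | j) (_ | l)
      · exact hy.2.2 i
      · simp only [Option.elim, Function.update_apply]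
        split_ifs with hl
        · exact hx.2.2 i
        · exact fun h => hl (h2 h).symm
      · exact hy.2.1 j
      · simp only [Option.elim, Function.update_apply]
        split_ifs with hl
        · exact hx.2.1 j
        · exact h3 _ _
    · rintro (_ | j)
      · exact h5 i
      · exact h4 j
    · rintro (_ | j)
      · exact hy.1
      · simp only [Option.elim, Function.update_apply]
        split_ifs with hl
        · exact hx.1
        · exact h5 j
    · rintro (_ | j)
      · exact hby
      · simp only [Option.elim, Function.update_apply]
        split_ifs with hl
        · rw [hl]; exact hax
        · exact h6 j
  -- swap
  let sw : Fin k → Prop := fun i => ∀ x ∈ R, ∀ y ∈ R, G.Adj (a i) x → G.Adj (a i) y → x = y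
  have hsw : ∀ i, ¬ sw i → ∀ x ∈ R, ∀ y ∈ R, G.Adj (b i) x → G.Adj (b i) y → x = y := by
    intro i hi x hx y hy hbx hby
    by_contra hxy
    apply hi
    intro z hz z' hz' haz haz'
    rw [haug i z hz x hx haz hbx, haug i z' hz' x hx haz' hbx]
  refine ⟨k, hkm, fun i => if sw i then a i else b i, fun i => if sw i then b i else a i, R,
    ?_, ?_, ?_, ?_, ?_, ?_, ?_, ?_, hRc, ?_, hind, ?_, ?_⟩
  · intro i j hij; simp only at hij
    split_ifs at hij
    exacts [h1 hij, absurd hij (h3 _ _), absurd hij.symm (h3 _ _), h2 hij]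
  · intro i j hij; simp only at hij
    split_ifs at hij
    exacts [h2 hij, absurd hij.symm (h3 _ _), absurd hij (h3 _ _), h1 hij]
  · intro i; dsimp only; split_ifs
    exacts [h4 i, h5 i]
  · intro i; dsimp only; split_ifs
    exacts [h5 i, h4 i]
  · intro i; dsimp only; rw [hRmem]; split_ifs
    exacts [fun h => h.2.1 i rfl, fun h => h.2.2 i rfl]
  · intro i; dsimp only; rw [hRmem]; split_ifs
    exacts [fun h => h.2.2 i rfl, fun h => h.2.1 i rfl]
  · exact sdiff_subset
  · intro x hx
    by_cases hxa : ∃ i, a i = x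
    · obtain ⟨i, rfl⟩ := hxa
      by_cases hs : sw i
      · exact Or.inr (Or.inl ⟨i, by simp [hs]⟩)
      · exact Or.inr (Or.inr ⟨i, by simp [hs]⟩)
    by_cases hxb : ∃ i, b i = x
    · obtain ⟨i, rfl⟩ := hxb
      by_cases hs : sw i
      · exact Or.inr (Or.inr ⟨i, by simp [hs]⟩)
      · exact Or.inr (Or.inl ⟨i, by simp [hs]⟩)
    · left; rw [hRmem]; push Not at hxa hxb; exact ⟨hx, hxa, hxb⟩
  · intro i; dsimp only; split_ifs
    exacts [h6 i, (h6 i).symm]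
  · intro i x hx y hy; dsimp only; split_ifs
    · exact haug i x hx y hy
    · exact fun h h' => (haug i y hy x hx h' h).symm
  · intro i; dsimp only; split_ifs with hs
    · exact hs
    · exact hsw i hs

lemma contains_fan {W : Type*} [Fintype W] {G : SimpleGraph W} [DecidableRel G.Adj] {m : ℕ} (v : W)
    (h : HM G m (univ.filter (fun y => G.Adj v y))) : Contains G (fan m) := by
  obtain ⟨a, b, h1, h2, h3, h4, h5, h6⟩ := h
  simp only [mem_filter, mem_univ, true_and] at h4 h5
  refine ⟨Sum.elim (fun _ => v) (fun p => if p.2 then a p.1 else b p.1), ?_, ?_⟩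
  · rintro (_ | ⟨i, c⟩) (_ | ⟨j, d⟩) hij
    · rfl
    · cases d
      · exact absurd hij (h5 j).ne
      · exact absurd hij (h4 j).ne
    · cases c
      · exact absurd hij.symm (h5 i).ne
      · exact absurd hij.symm (h4 i).ne
    · cases c <;> cases d <;> simp only [Sum.elim_inr, if_true, Bool.false_eq_true, if_false] at hij
      · rw [h2 hij]
      · exact absurd hij.symm (h3 _ _)
      · exact absurd hij (h3 _ _)
      · rw [h1 hij]
  · intro x y hxy
    have key : ∀ x y, x ≠ y → ((∃ u, x = Sum.inl u) ∨ ∃ i : Fin m, x = Sum.inr (i, true) ∧ y = Sum.inr (i, false)) →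
        G.Adj (Sum.elim (fun _ : Unit => v) (fun p : Fin m × Bool => if p.2 then a p.1 else b p.1) x)
         (Sum.elim (fun _ : Unit => v) (fun p : Fin m × Bool => if p.2 then a p.1 else b p.1) y) := by
      rintro x y hne (⟨u, rfl⟩ | ⟨i, rfl, rfl⟩)
      · rcases y with _ | ⟨j, d⟩
        · exact absurd rfl hne
        · cases d
          · simpa using h5 j
          · simpa using h4 j
      · simpa using h6 i
    rw [fan, SimpleGraph.fromRel_adj] at hxy
    rcases hxy with ⟨hne, h | h⟩
    · exact key x y hne h
    · exact (key y x hne.symm h).symm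

lemma nonisolated_card {W : Type*} [DecidableEq W] {G : SimpleGraph W} [DecidableRel G.Adj]
    {m Δ : ℕ} {S : Finset W} (h : ¬ HM G m S) (hΔ : 2 ≤ Δ)
    (hdeg : ∀ x ∈ S, (S.filter (fun y => G.Adj x y)).card ≤ Δ) :
    (S.filter (fun x => ∃ y ∈ S, G.Adj x y)).card + (Δ + 1) ≤ m * (Δ + 1) := by
  obtain ⟨k, hk, a, b, R, h1, h2, h4, h5, h7, h8, hRS, hcov, hRc, h6, hind, haug, hsw⟩ := HM.decomp h
  have hsub : S.filter (fun x => ∃ y ∈ S, G.Adj x y) ⊆ (univ : Finset (Fin k)).biUnion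
      (fun i => {a i, b i} ∪ R.filter (fun x => G.Adj (a i) x ∨ G.Adj (b i) x)) := by
    intro x hx
    simp only [mem_filter] at hx
    obtain ⟨hxS, y, hyS, hxy⟩ := hx
    simp only [mem_biUnion, mem_univ, true_and, mem_union, mem_insert, mem_singleton, mem_filter]
    rcases hcov x hxS with hxR | ⟨i, rfl⟩ | ⟨i, rfl⟩
    · rcases hcov y hyS with hyR | ⟨i, rfl⟩ | ⟨i, rfl⟩
      · exact absurd hxy (hind x hxR y hyR)
      · exact ⟨i, Or.inr ⟨hxR, Or.inl hxy.symm⟩⟩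
      · exact ⟨i, Or.inr ⟨hxR, Or.inr hxy.symm⟩⟩
    · exact ⟨i, Or.inl (Or.inl rfl)⟩
    · exact ⟨i, Or.inl (Or.inr rfl)⟩
  have hle : ∀ i ∈ (univ : Finset (Fin k)),
      ({a i, b i} ∪ R.filter (fun x => G.Adj (a i) x ∨ G.Adj (b i) x)).card ≤ Δ + 1 := by
    intro i _
    have hR1 : (R.filter (fun x => G.Adj (a i) x ∨ G.Adj (b i) x)).card ≤ Δ - 1 := by
      by_cases hx : ∃ x ∈ R, G.Adj (a i) x
      · obtain ⟨x, hxR, hax⟩ := hx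
        have : R.filter (fun x => G.Adj (a i) x ∨ G.Adj (b i) x) ⊆ {x} := by
          intro y; simp only [mem_filter, mem_singleton]
          rintro ⟨hy, h | h⟩
          · exact hsw i y hy x hxR h hax
          · exact (haug i x hxR y hy hax h).symm
        have := card_le_card this
        simp only [card_singleton] at this
        omega
      · have hs : R.filter (fun x => G.Adj (a i) x ∨ G.Adj (b i) x) ⊆
            (S.filter (fun y => G.Adj (b i) y)).erase (a i) := by
          intro y; simp only [mem_filter, mem_erase]
          rintro ⟨hy, h | h⟩
          · exact absurd ⟨y, hy, h⟩ hx
          · exact ⟨fun h => h7 i (h ▸ hy), hRS hy, h⟩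
        have hc := card_le_card hs
        rw [card_erase_of_mem (by simp only [mem_filter]; exact ⟨h4 i, (h6 i).symm⟩)] at hc
        have := hdeg _ (h5 i)
        omega
    have h2c : ({a i, b i} : Finset W).card ≤ 2 := card_le_two
    have := card_union_le ({a i, b i} : Finset W) (R.filter (fun x => G.Adj (a i) x ∨ G.Adj (b i) x))
    omega
  have h1' := card_le_card hsub
  have h2' := card_biUnion_le_card_mul _ _ _ hle
  simp only [card_univ, Fintype.card_fin] at h2'
  have h3' : (k + 1) * (Δ + 1) ≤ m * (Δ + 1) := Nat.mul_le_mul_right _ hk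
  have h4' : (k + 1) * (Δ + 1) = k * (Δ + 1) + (Δ + 1) := by ring
  omega

lemma card_filter_split {W : Type*} [Fintype W] [DecidableEq W] {X Y : Finset W}
    (hXY : X ∪ Y = univ) (hd : Disjoint X Y) (p : W → Prop) [DecidablePred p] :
    (univ.filter p).card = (X.filter p).card + (Y.filter p).card := by
  rw [← hXY, filter_union, card_union_of_disjoint]
  exact disjoint_filter_filter hd

lemma inter_card {W : Type*} [DecidableEq W] (Y : Finset W) (p q : W → Prop) [DecidablePred p]
    [DecidablePred q] : (Y.filter p).card + (Y.filter q).card ≤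
      Y.card + ((Y.filter p).filter q).card := by
  rw [filter_filter, ← card_union_add_card_inter, ← filter_or, ← filter_and]
  have := card_filter_le Y (fun a => p a ∨ q a)
  omega

lemma star_final {W : Type*} [Fintype W] [DecidableEq W] {G : SimpleGraph W} [DecidableRel G.Adj]
    (m n : ℕ) (hm : 9 ≤ m) (hn : m * (m - 1) + 1 ≤ n) (hcard : Fintype.card W = 2 * n - 1)
    (hF : ∀ v, ¬ HM G m (univ.filter (fun y => G.Adj v y)))
    (hdeg : ∀ v, n ≤ (univ.filter (fun y => G.Adj v y)).card)
    (X Y : Finset W) (hXY : X ∪ Y = univ) (hd : Disjoint X Y) (hXne : X.Nonempty)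
    (hX : ∀ x ∈ X, (X.filter (fun y => G.Adj x y)).card ≤ m - 1)
    (hY : ∀ x ∈ Y, (Y.filter (fun y => G.Adj x y)).card ≤ m - 1)
    (hXc : X.card ≤ n - 1) : False := by
  have hn9 : 9 * m - 8 ≤ n := by
    obtain ⟨M, rfl⟩ : ∃ M, m = M + 1 := ⟨m - 1, by omega⟩
    simp only [Nat.add_sub_cancel] at hn
    nlinarith [show 9 * (M+1) - 8 = 9 * M + 1 by omega]
  have hsum : X.card + Y.card = 2 * n - 1 := by
    rw [← card_union_of_disjoint hd, hXY, card_univ, hcard]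
  obtain ⟨t, ht⟩ : ∃ t, X.card + t + 1 = n := ⟨n - 1 - X.card, by omega⟩
  have hYc : Y.card = n + t := by omega
  have hYdeg : ∀ y ∈ Y, t + 1 ≤ (Y.filter (fun z => G.Adj y z)).card := by
    intro y hy
    have h1 := hdeg y
    rw [card_filter_split hXY hd] at h1
    have h2 := card_filter_le X (fun z => G.Adj y z)
    omega
  have htm : t + 1 ≤ m - 1 := by
    obtain ⟨y, hy⟩ : Y.Nonempty := by rw [← card_pos]; omega
    exact (hYdeg y hy).trans (hY y hy)
  have hXdeg : ∀ x ∈ X, n ≤ (X.filter (fun z => G.Adj x z)).card +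
      (Y.filter (fun z => G.Adj x z)).card := by
    intro x hx
    have h1 := hdeg x
    rwa [card_filter_split hXY hd] at h1
  obtain ⟨v, hv⟩ := hXne
  set D := X.filter (fun y => G.Adj v y) with hD
  set S := Y.filter (fun y => G.Adj v y) with hS
  set i := D.card with hi
  have him : i ≤ m - 1 := hX v hv
  have hSc : n ≤ i + S.card := hXdeg v hv
  have hno : ¬ HM G (m - i) S := by
    intro hH
    obtain ⟨U, hUS, hUc, hU⟩ := hH.exists_sub
    refine hF v ?_
    have := HM.greedy (G := G) (m - i) i (univ.filter (fun y => G.Adj v y)) D U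
      (by rw [hD]; exact filter_subset_filter _ (subset_univ _))
      (hUS.trans (by rw [hS]; exact filter_subset_filter _ (subset_univ _))) rfl hU
      (by
        rw [disjoint_left]; intro z hz hz'
        exact disjoint_left.1 hd (mem_filter.1 hz).1 (mem_filter.1 (hUS hz')).1) ?_
    · rwa [show m - i + i = m by omega] at this
    · intro d hdD
      have hdX : d ∈ X := (mem_filter.1 hdD).1
      have h1 := hXdeg d hdX
      have h2 := hX d hdX
      have h3 := inter_card Y (fun y => G.Adj v y) (fun y => G.Adj d y)
      rw [← hS] at h3
      have h4 : (S.filter (fun y => G.Adj d y)) \ U ⊆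
          (((univ.filter (fun y => G.Adj v y)) \ D) \ U).filter (fun y => G.Adj d y) := by
        intro z; simp only [mem_sdiff, mem_filter, hS, hD, mem_univ, true_and]
        rintro ⟨⟨⟨h1, h2⟩, h3⟩, h4⟩
        exact ⟨⟨⟨h2, fun h => disjoint_left.1 hd h.1 h1⟩, h4⟩, h3⟩
      have h5 := card_le_card h4
      have h6 := le_card_sdiff U (S.filter (fun y => G.Adj d y))
      omega
  have hNI := nonisolated_card (Δ := m - 1) hno (by omega) (by
    intro x hx
    have hxY : x ∈ Y := (mem_filter.1 hx).1
    refine (card_le_card (filter_subset_filter _ ?_)).trans (hY x hxY)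
    exact filter_subset _ _)
  set Iso := S.filter (fun x => ¬ ∃ y ∈ S, G.Adj x y) with hIso
  have hsp := card_filter_add_card_filter_not (s := S) (fun x => ∃ y ∈ S, G.Adj x y)
  rw [← hIso] at hsp
  set Z := Y.filter (fun y => ¬ G.Adj v y) with hZ
  have hZc := card_filter_add_card_filter_not (s := Y) (fun y => G.Adj v y)
  rw [← hZ, ← hS] at hZc
  have hdc : Iso.card * (t + 1) ≤ Z.card * (m - 1) := by
    refine card_mul_le_card_mul (fun x y => G.Adj x y) ?_ ?_
    · intro x hx
      simp only [hIso, mem_filter] at hx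
      have hxY : x ∈ Y := (mem_filter.1 hx.1).1
      refine (hYdeg x hxY).trans (card_le_card ?_)
      intro z; simp only [mem_filter, bipartiteAbove, hZ]
      rintro ⟨h1, h2⟩
      exact ⟨⟨h1, fun h => hx.2 ⟨z, mem_filter.2 ⟨h1, h⟩, h2⟩⟩, h2⟩
    · intro z hz
      have hzY : z ∈ Y := (mem_filter.1 hz).1
      refine (card_le_card ?_).trans (hY z hzY)
      intro x; simp only [mem_filter, bipartiteBelow, hIso, hS]
      rintro ⟨⟨⟨h1, _⟩, _⟩, h2⟩
      exact ⟨h1, h2.symm⟩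
  obtain ⟨M, rfl⟩ : ∃ M, m = M + 1 := ⟨m - 1, by omega⟩
  simp only [Nat.add_sub_cancel] at *
  obtain ⟨j, hj⟩ : ∃ j, M = i + j := ⟨M - i, by omega⟩
  rw [show M + 1 - i = j + 1 by omega] at hNI
  have hZle : Z.card ≤ t + i := by omega
  have hIsoge : 1 + i * M ≤ Iso.card := by
    have e1 : (j + 1) * (M + 1) = j * (M + 1) + (M + 1) := by ring
    have e2 : (M + 1) * M = j * (M + 1) + i * M + i := by rw [hj]; ring
    omega
  have hA : (1 + i * M) * (t + 1) ≤ (t + i) * M :=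
    (Nat.mul_le_mul_right _ hIsoge).trans (hdc.trans (Nat.mul_le_mul_right _ hZle))
  rcases Nat.eq_zero_or_pos i with h0 | hpos
  · have hZt : Z.card ≤ t := by omega
    -- an isolated vertex has at least t + 1 neighbours in Z
    obtain ⟨x, hx⟩ : Iso.Nonempty := by rw [← card_pos]; omega
    simp only [hIso, mem_filter] at hx
    have hxY : x ∈ Y := (mem_filter.1 hx.1).1
    have h1 : Y.filter (fun z => G.Adj x z) ⊆ Z := by
      intro z; simp only [mem_filter, hZ]
      rintro ⟨h1, h2⟩
      exact ⟨h1, fun h => hx.2 ⟨z, mem_filter.2 ⟨h1, h⟩, h2⟩⟩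
    have := card_le_card h1
    have := hYdeg x hxY
    omega
  · have : t * M ≤ i * (t * M) := Nat.le_mul_of_pos_left _ hpos
    nlinarith

lemma star_lemma {W : Type*} [Fintype W] [DecidableEq W] {G : SimpleGraph W} [DecidableRel G.Adj]
    (m n : ℕ) (hm : 9 ≤ m) (hn : m * (m - 1) + 1 ≤ n) (hcard : Fintype.card W = 2 * n - 1)
    (hF : ∀ v, ¬ HM G m (univ.filter (fun y => G.Adj v y)))
    (hdeg : ∀ v, n ≤ (univ.filter (fun y => G.Adj v y)).card) : False := by
  have hn9 : 9 * m - 8 ≤ n := by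
    obtain ⟨M, rfl⟩ : ∃ M, m = M + 1 := ⟨m - 1, by omega⟩
    simp only [Nat.add_sub_cancel] at hn
    nlinarith [show 9 * (M+1) - 8 = 9 * M + 1 by omega]
  obtain ⟨v0⟩ : Nonempty W := by rw [← Fintype.card_pos_iff]; omega
  obtain ⟨k, hk, _, _, A, -, -, -, -, -, -, hRS, -, hRc, -, hind, -, -⟩ := HM.decomp (hF v0)
  have hAge : n ≤ A.card + 2 * (m - 1) := by have := hdeg v0; omega
  set B := Aᶜ with hB
  have hAB : A ∪ B = univ := by simp [hB]
  have hABd : Disjoint A B := by rw [hB]; exact disjoint_compl_right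
  have hABc : A.card + B.card = 2 * n - 1 := by
    rw [← card_union_of_disjoint hABd, hAB, card_univ, hcard]
  have hsplit : ∀ u, n ≤ (A.filter (fun y => G.Adj u y)).card +
      (B.filter (fun y => G.Adj u y)).card := by
    intro u; have := hdeg u; rwa [card_filter_split hAB hABd] at this
  have hA0 : ∀ a ∈ A, (A.filter (fun y => G.Adj a y)).card = 0 := by
    intro a ha; rw [card_eq_zero, filter_eq_empty_iff]
    exact fun y hy => hind a ha y hy
  obtain ⟨a0, ha0⟩ : A.Nonempty := by rw [← card_pos]; omega
  have hAle : A.card ≤ n - 1 := by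
    have h1 := hsplit a0
    rw [hA0 a0 ha0] at h1
    have := card_filter_le B (fun y => G.Adj a0 y)
    omega
  set X := univ.filter (fun u => (A.filter (fun y => G.Adj u y)).card ≤ m - 1) with hX
  set Y := univ.filter (fun u => ¬ (A.filter (fun y => G.Adj u y)).card ≤ m - 1) with hY
  have hXY : X ∪ Y = univ := filter_union_filter_not_eq _ _
  have hXYd : Disjoint X Y := disjoint_filter_filter_not _ _ _
  have hYA : ∀ u ∈ Y, u ∉ A := by
    intro u hu hA
    simp only [hY, mem_filter, hA0 u hA] at hu
    omega
  have hYB : ∀ u ∈ Y, (B.filter (fun y => G.Adj u y)).card ≤ 3 * (m - 1) - 1 := by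
    intro u hu
    by_contra hcon
    simp only [hY, mem_filter] at hu
    obtain ⟨D, hDs, hDc⟩ := exists_subset_card_eq (s := A.filter (fun y => G.Adj u y)) (n := m)
      (by omega)
    refine hF u (HM.greedy' m _ D (B.filter (fun y => G.Adj u y)) ?_ ?_ hDc ?_ ?_)
    · exact hDs.trans (filter_subset_filter _ (subset_univ _))
    · exact filter_subset_filter _ (subset_univ _)
    · exact (disjoint_filter_filter hABd).mono_left hDs
    · intro d hd
      have hdA : d ∈ A := (mem_filter.1 (hDs hd)).1
      have h1 := hsplit d
      rw [hA0 d hdA] at h1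
      have h2 := inter_card B (fun y => G.Adj u y) (fun y => G.Adj d y)
      omega
  have hYin : ∀ x ∈ Y, (Y.filter (fun y => G.Adj x y)).card ≤ m - 1 := by
    intro u hu
    by_contra hcon
    obtain ⟨D, hDs, hDc⟩ := exists_subset_card_eq (s := Y.filter (fun y => G.Adj u y)) (n := m)
      (by omega)
    refine hF u (HM.greedy' m _ D (A.filter (fun y => G.Adj u y)) ?_ ?_ hDc ?_ ?_)
    · exact hDs.trans (filter_subset_filter _ (subset_univ _))
    · exact filter_subset_filter _ (subset_univ _)
    · rw [disjoint_left]; intro z hz hz'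
      exact hYA z (mem_filter.1 (hDs hz)).1 (mem_filter.1 hz').1
    · intro d hd
      have hdY : d ∈ Y := (mem_filter.1 (hDs hd)).1
      have h1 := hsplit d
      have h1' := hsplit u
      have h3 := hYB d hdY
      have h3' := hYB u hu
      have h2 := inter_card A (fun y => G.Adj u y) (fun y => G.Adj d y)
      omega
  have hXin : ∀ x ∈ X, (X.filter (fun y => G.Adj x y)).card ≤ m - 1 := by
    intro u hu
    by_contra hcon
    obtain ⟨D, hDs, hDc⟩ := exists_subset_card_eq (s := X.filter (fun y => G.Adj u y)) (n := m)
      (by omega)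
    refine hF u (HM.greedy' m _ D (B.filter (fun y => G.Adj u y) \ D) ?_ ?_ hDc ?_ ?_)
    · exact hDs.trans (filter_subset_filter _ (subset_univ _))
    · exact sdiff_subset.trans (filter_subset_filter _ (subset_univ _))
    · exact disjoint_sdiff
    · intro d hd
      have hdX : d ∈ X := (mem_filter.1 (hDs hd)).1
      have h1 := hsplit d
      have h1' := hsplit u
      have h3 := (mem_filter.1 hdX).2
      have h3' := (mem_filter.1 hu).2
      have h2 := inter_card B (fun y => G.Adj u y) (fun y => G.Adj d y)
      have h4 : ((B.filter (fun y => G.Adj u y)).filter (fun y => G.Adj d y)) \ D ⊆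
          (B.filter (fun y => G.Adj u y) \ D).filter (fun y => G.Adj d y) := by
        intro z; simp only [mem_sdiff, mem_filter]; tauto
      have h5 := card_le_card h4
      have h6 := le_card_sdiff D ((B.filter (fun y => G.Adj u y)).filter (fun y => G.Adj d y))
      omega
  have hXYc : X.card + Y.card = 2 * n - 1 := by
    rw [← card_union_of_disjoint hXYd, hXY, card_univ, hcard]
  have ha0X : a0 ∈ X := by simp [hX, hA0 a0 ha0]
  by_cases hc : X.card ≤ n - 1
  · exact star_final m n hm hn hcard hF hdeg X Y hXY hXYd ⟨a0, ha0X⟩ hXin hYin hc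
  · refine star_final m n hm hn hcard hF hdeg Y X (by rw [union_comm]; exact hXY) hXYd.symm ?_
      hYin hXin (by omega)
    rw [← card_pos]
    have h1 := hdeg a0
    rw [card_filter_split hXY hXYd] at h1
    have h2 := hXin a0 ha0X
    have h3 := card_filter_le Y (fun y => G.Adj a0 y)
    omega

/-- injecting a finset into another one -/
lemma exists_inj_into {V W : Type*} [Nonempty W] (A : Finset V) (P : Finset W)
    (h : A.card ≤ P.card) : ∃ f : V → W, (∀ a ∈ A, f a ∈ P) ∧ Set.InjOn f A := by
  classical
  obtain ⟨f, hf, hinj⟩ := A.finite_toSet.exists_injOn_of_encard_le (t := (P : Set W))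
    (by simpa using h)
  exact ⟨f, fun a ha => by simpa using hf ha, hinj⟩

lemma tree_degree_facts {V : Type*} [Fintype V] {T : SimpleGraph V}
    [DecidableRel T.Adj] (hT : T.IsTree) (h2 : 2 ≤ Fintype.card V) :
    (∀ v, 1 ≤ T.degree v) ∧ ∑ v, T.degree v + 2 = 2 * Fintype.card V := by
  classical
  have : Nontrivial V := Fintype.one_lt_card_iff_nontrivial.1 (by omega)
  refine ⟨fun v => hT.connected.preconnected.degree_pos_of_nontrivial v, ?_⟩
  rw [T.sum_degrees_eq_twice_card_edges]
  have := hT.card_edgeFinset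
  omega

lemma exists_indep {V : Type*} [Fintype V] [DecidableEq V] {T : SimpleGraph V}
    [DecidableRel T.Adj] (hT : T.IsTree) (h2 : 2 ≤ Fintype.card V) (q : ℕ)
    (hq : 4 * q ≤ Fintype.card V) :
    ∃ I : Finset V, I.card = q ∧ (∀ x ∈ I, ∀ y ∈ I, ¬ T.Adj x y) ∧
      (I.biUnion (fun u => T.neighborFinset u)).card ≤ 2 * q := by
  obtain ⟨hpos, hsum⟩ := tree_degree_facts hT h2
  obtain ⟨c⟩ := hT.colorable_two
  set L := univ.filter (fun v => T.degree v ≤ 2) with hL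
  have hLc : Fintype.card V ≤ 2 * L.card := by
    have h1 : ∑ v : V, (3 - (if T.degree v ≤ 2 then 2 else 0)) ≤ ∑ v, T.degree v := by
      apply sum_le_sum
      intro v _
      have := hpos v
      split_ifs <;> omega
    have h3 : ∑ v : V, (3 - (if T.degree v ≤ 2 then 2 else 0)) +
        ∑ v : V, (if T.degree v ≤ 2 then 2 else 0) = 3 * Fintype.card V := by
      rw [← sum_add_distrib, sum_congr rfl (g := fun _ => 3)]
      · simp [mul_comm]
      · intro v _; split_ifs <;> omega
    have h4 : ∑ v : V, (if T.degree v ≤ 2 then 2 else 0) = 2 * L.card := by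
      rw [← sum_filter, sum_const, smul_eq_mul, mul_comm]
    omega
  have hsp := card_filter_add_card_filter_not (s := L) (fun x => c x = 0)
  have key : ∀ C ⊆ L, (∀ x ∈ C, ∀ y ∈ C, c x = c y) → q ≤ C.card →
      ∃ I : Finset V, I.card = q ∧ (∀ x ∈ I, ∀ y ∈ I, ¬ T.Adj x y) ∧
      (I.biUnion (fun u => T.neighborFinset u)).card ≤ 2 * q := by
    intro C hC hcc hqC
    obtain ⟨I, hI, hIc⟩ := exists_subset_card_eq hqC
    refine ⟨I, hIc, fun x hx y hy hxy => c.valid hxy (hcc x (hI hx) y (hI hy)), ?_⟩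
    have := card_biUnion_le_card_mul I (fun u => T.neighborFinset u) 2 (by
      intro x hx
      rw [T.card_neighborFinset_eq_degree]
      exact (mem_filter.1 (hC (hI hx))).2)
    omega
  by_cases hc : q ≤ (L.filter (fun x => c x = 0)).card
  · refine key _ (filter_subset _ _) ?_ hc
    intro x hx y hy
    rw [(mem_filter.1 hx).2, (mem_filter.1 hy).2]
  · refine key (L.filter (fun x => ¬ c x = 0)) (filter_subset _ _) ?_ (by omega)
    intro x hx y hy
    have h1 := (mem_filter.1 hx).2
    have h2 := (mem_filter.1 hy).2
    omega

/-- A large set without an `m`-matching contains every tree in the complement. -/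
lemma tree_in_compl {V W : Type*} [Fintype V] [DecidableEq V] [Fintype W] [DecidableEq W]
    {T : SimpleGraph V} [DecidableRel T.Adj] (hT : T.IsTree) {G : SimpleGraph W}
    [DecidableRel G.Adj] (m n : ℕ) (hm : 9 ≤ m) (hn : 9 * m - 8 ≤ n)
    (hV : Fintype.card V = n) (S : Finset W) (hS : n + m - 1 ≤ S.card) (h : ¬ HM G m S) :
    Contains Gᶜ T := by
  obtain ⟨k, hk, a, b, R, h1, h2, h4, h5, h7, h8, hRS, hcov, hRc, h6, hind, haug, hsw⟩ :=
    HM.decomp h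
  obtain ⟨r0, hr0⟩ : R.Nonempty := by rw [← card_pos]; omega
  have : Nonempty W := ⟨r0⟩
  obtain ⟨I, hIc, hI, hNc⟩ := exists_indep hT (by omega) (n - R.card) (by omega)
  set N := I.biUnion (fun u => T.neighborFinset u) with hN
  set Bad := R.filter (fun r => ∃ i, G.Adj (a i) r) with hBad
  have hBadc : Bad.card ≤ k := by
    have hle : Bad ⊆ (univ : Finset (Fin k)).biUnion (fun i => R.filter (fun r => G.Adj (a i) r)) := by
      intro r; simp only [hBad, mem_filter, mem_biUnion, mem_univ, true_and]
      rintro ⟨h, i, hi⟩; exact ⟨i, h, hi⟩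
    have h1 := card_le_card hle
    have h2 := card_biUnion_le_card_mul (univ : Finset (Fin k))
      (fun i => R.filter (fun r => G.Adj (a i) r)) 1 (by
        intro i _
        rw [card_le_one]
        intro x hx y hy
        rw [mem_filter] at hx hy
        exact hsw i x hx.1 y hy.1 hx.2 hy.2)
    simp only [card_univ, Fintype.card_fin] at h2
    omega
  obtain ⟨f1, hf1, hf1i⟩ := exists_inj_into I (univ.image a) (by
    rw [card_image_of_injective _ h1, card_univ, Fintype.card_fin]; omega)
  have hNI : Disjoint N I := by
    rw [disjoint_left]; intro x hx hxI
    simp only [hN, mem_biUnion, SimpleGraph.mem_neighborFinset] at hx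
    obtain ⟨y, hy, hyx⟩ := hx
    exact hI y hy x hxI hyx
  obtain ⟨f2, hf2, hf2i⟩ := exists_inj_into N (R \ Bad) (by
    have := le_card_sdiff Bad R
    omega)
  have him : N.image f2 ⊆ R := by
    intro x hx; obtain ⟨y, hy, rfl⟩ := mem_image.1 hx
    exact (mem_sdiff.1 (hf2 y hy)).1
  obtain ⟨f3, hf3, hf3i⟩ := exists_inj_into (univ \ (N ∪ I)) (R \ N.image f2) (by
    rw [card_sdiff_of_subset him, card_image_of_injOn hf2i, card_sdiff_of_subset (subset_univ _),
      card_union_of_disjoint hNI, card_univ, hV]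
    omega)
  have hf1' : ∀ x ∈ I, ∃ i, f1 x = a i := by
    intro x hx; obtain ⟨i, _, hi⟩ := mem_image.1 (hf1 x hx); exact ⟨i, hi.symm⟩
  set f : V → W := fun x => if x ∈ I then f1 x else if x ∈ N then f2 x else f3 x with hf
  have fI : ∀ x ∈ I, f x = f1 x := by intro x hx; simp [hf, hx]
  have fN : ∀ x ∉ I, x ∈ N → f x = f2 x := by intro x hx hx'; simp [hf, hx, hx']
  have fO : ∀ x ∉ I, x ∉ N → f x = f3 x := by intro x hx hx'; simp [hf, hx, hx']
  have memO : ∀ x ∉ I, x ∉ N → x ∈ univ \ (N ∪ I) := by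
    intro x hx hx'; simp [hx, hx']
  have fR : ∀ x ∉ I, f x ∈ R := by
    intro x hx
    by_cases hx' : x ∈ N
    · rw [fN x hx hx']; exact (mem_sdiff.1 (hf2 x hx')).1
    · rw [fO x hx hx']; exact (mem_sdiff.1 (hf3 x (memO x hx hx'))).1
  have fInR : ∀ x ∈ I, f x ∉ R := by
    intro x hx; rw [fI x hx]; obtain ⟨i, hi⟩ := hf1' x hx; rw [hi]; exact h7 i
  have finj : Function.Injective f := by
    intro x y hxy
    by_cases hx : x ∈ I
    · by_cases hy : y ∈ I
      · rw [fI x hx, fI y hy] at hxy; exact hf1i hx hy hxy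
      · exact absurd (hxy ▸ fR y hy) (fInR x hx)
    · by_cases hy : y ∈ I
      · exact absurd (hxy ▸ fR x hx) (fInR y hy)
      · by_cases hx' : x ∈ N
        · by_cases hy' : y ∈ N
          · rw [fN x hx hx', fN y hy hy'] at hxy; exact hf2i hx' hy' hxy
          · rw [fN x hx hx', fO y hy hy'] at hxy
            exact absurd (mem_image.2 ⟨x, hx', hxy⟩) (mem_sdiff.1 (hf3 y (memO y hy hy'))).2
        · by_cases hy' : y ∈ N
          · rw [fO x hx hx', fN y hy hy'] at hxy
            exact absurd (mem_image.2 ⟨y, hy', hxy.symm⟩) (mem_sdiff.1 (hf3 x (memO x hx hx'))).2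
          · rw [fO x hx hx', fO y hy hy'] at hxy
            exact hf3i (memO x hx hx') (memO y hy hy') hxy
  have hkey : ∀ u v, T.Adj u v → u ∈ I → ¬ G.Adj (f u) (f v) := by
    intro u v huv hu hG
    have hv : v ∉ I := fun hv => hI u hu v hv huv
    have hvN : v ∈ N := by
      simp only [hN, mem_biUnion, SimpleGraph.mem_neighborFinset]; exact ⟨u, hu, huv⟩
    have h9 := mem_sdiff.1 (hf2 v hvN)
    rw [fI u hu, fN v hv hvN] at hG
    obtain ⟨i, hi⟩ := hf1' u hu
    rw [hi] at hG
    exact h9.2 (mem_filter.2 ⟨h9.1, i, hG⟩)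
  refine ⟨f, finj, ?_⟩
  intro u v huv
  rw [SimpleGraph.compl_adj]
  refine ⟨fun h => huv.ne (finj h), ?_⟩
  by_cases hu : u ∈ I
  · exact hkey u v huv hu
  · by_cases hv : v ∈ I
    · exact fun h => hkey v u huv.symm hv h.symm
    · exact hind _ (fR u hu) _ (fR v hv)

/-- Parent function of a rooted tree. -/
lemma exists_parent {V : Type*} {T : SimpleGraph V} (hT : T.IsTree) (r : V) :
    ∃ (p : V → V) (l : V → ℕ), (∀ w, w ≠ r → T.Adj w (p w) ∧ l (p w) < l w) ∧
      ∀ a b, T.Adj a b → (a ≠ r ∧ p a = b) ∨ (b ≠ r ∧ p b = a) := by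
  classical
  choose P hP using fun w => (hT.existsUnique_path w r).exists
  have hu : ∀ w (q : T.Walk w r), q.IsPath → q = P w := fun w q hq =>
    (hT.existsUnique_path w r).unique hq (hP w)
  refine ⟨fun w => (P w).snd, fun w => (P w).length, ?_, ?_⟩
  · intro w hw
    have hnil : ¬ (P w).Nil := SimpleGraph.Walk.not_nil_of_ne hw
    refine ⟨(P w).adj_snd hnil, ?_⟩
    have h1 : (P w).tail = P (P w).snd := hu _ _ (hP w).tail
    have h2 := SimpleGraph.Walk.length_tail_add_one hnil
    rw [h1] at h2
    dsimp only
    omega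
  · intro a b hab
    by_cases hb : b ∈ (P a).support
    · left
      refine ⟨?_, (hT.isAcyclic.eq_snd_of_adj_start (hP a) hab hb).symm⟩
      rintro rfl
      have : P a = SimpleGraph.Walk.nil := ((hu a SimpleGraph.Walk.nil (by simp))).symm
      rw [this] at hb
      simp at hb
      exact hab.ne hb.symm
    · right
      have h1 : (SimpleGraph.Walk.cons hab.symm (P a)) = P b :=
        hu b _ ((hP a).cons hb)
      refine ⟨?_, by dsimp only; rw [← h1]; simp⟩
      rintro rfl
      exact hb (P a).end_mem_support

lemma tree_greedy {V W : Type*} [Fintype V] [DecidableEq V] [Fintype W] [DecidableEq W]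
    {T : SimpleGraph V} (hT : T.IsTree) {H : SimpleGraph W} [DecidableRel H.Adj]
    (d : ℕ) (v : V) (x : W) (L : Finset V) (hL : ∀ l ∈ L, ∀ w, T.Adj l w → w = v)
    (hvL : v ∉ L) (hc : Fintype.card V ≤ d + 1 + L.card)
    (hdeg : ∀ w, d ≤ (univ.filter (fun y => H.Adj w y)).card)
    (hx : Fintype.card V ≤ (univ.filter (fun y => H.Adj x y)).card + 1) : Contains H T := by
  obtain ⟨p, l, hp, hadj⟩ := exists_parent hT v
  have hLc : L.card + (univ \ L).card = Fintype.card V := by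
    have := card_sdiff_add_card_eq_card (subset_univ L)
    rw [card_univ] at this
    omega
  have step : ∀ j, j + 1 ≤ (univ \ L).card → ∃ (U : Finset V) (f : V → W), U ⊆ univ \ L ∧ v ∈ U ∧
      U.card = j + 1 ∧ (∀ w ∈ U, w ≠ v → p w ∈ U) ∧ f v = x ∧ Set.InjOn f U ∧
      ∀ a ∈ U, ∀ b ∈ U, T.Adj a b → H.Adj (f a) (f b) := by
    intro j
    induction j with
    | zero =>
      intro _
      refine ⟨{v}, fun _ => x, by simp [hvL], by simp, by simp, by simp, rfl, by simp, ?_⟩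
      intro a ha b hb hab
      rw [mem_singleton] at ha hb
      exact absurd (ha.trans hb.symm) hab.ne
    | succ j ih =>
      intro hj
      obtain ⟨U, f, hU, hvU, hUc, hcl, hfv, hinj, hhom⟩ := ih (by omega)
      have hne : ((univ \ L) \ U).Nonempty := by
        rw [← card_pos, card_sdiff_of_subset hU]; omega
      obtain ⟨w, hw, hmin⟩ := exists_min_image ((univ \ L) \ U) l hne
      simp only [mem_sdiff, mem_univ, true_and] at hw hmin
      have hwv : w ≠ v := fun h => hw.2 (h ▸ hvU)
      obtain ⟨hwp, hlp⟩ := hp w hwv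
      have hpU : p w ∈ U := by
        by_contra hcon
        have hpL : p w ∉ L := fun h => hwv (hL _ h w hwp.symm)
        have := hmin (p w) ⟨hpL, hcon⟩
        omega
      have hex : ((univ.filter (fun y => H.Adj (f (p w)) y)) \ ((U.erase (p w)).image f)).Nonempty := by
        rw [← card_pos]
        have h1 := le_card_sdiff ((U.erase (p w)).image f) (univ.filter (fun y => H.Adj (f (p w)) y))
        have h2 := card_image_le (s := U.erase (p w)) (f := f)
        rw [card_erase_of_mem hpU] at h2
        have h3 := hdeg (f (p w))
        omega
      obtain ⟨y, hy⟩ := hex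
      simp only [mem_sdiff, mem_filter, mem_univ, true_and, mem_image, mem_erase, not_exists,
        not_and] at hy
      have hyU : ∀ u ∈ U, f u ≠ y := by
        intro u hu huy
        by_cases hup : u = p w
        · rw [← huy, hup] at hy; exact hy.1.ne rfl
        · exact hy.2 u ⟨hup, hu⟩ huy
      have hne' : ∀ u ∈ U, u ≠ w := fun u hu h => hw.2 (h ▸ hu)
      have hfu : ∀ u ∈ U, Function.update f w y u = f u := fun u hu =>
        Function.update_of_ne (hne' u hu) _ _
      have hfw : Function.update f w y w = y := Function.update_self ..
      have hedge : ∀ u ∈ U, T.Adj w u → p w = u := by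
        intro u hu hwu
        rcases hadj w u hwu with h | h
        · exact h.2
        · exact absurd (h.2 ▸ hcl u hu h.1) hw.2
      refine ⟨insert w U, Function.update f w y, ?_, ?_, ?_, ?_, ?_, ?_, ?_⟩
      · intro z hz; rcases mem_insert.1 hz with rfl | hz
        · simp [hw.1]
        · exact hU hz
      · exact mem_insert_of_mem hvU
      · rw [card_insert_of_notMem hw.2, hUc]
      · intro z hz hzv
        rcases mem_insert.1 hz with rfl | hz
        · exact mem_insert_of_mem hpU
        · exact mem_insert_of_mem (hcl z hz hzv)
      · rw [hfu v hvU, hfv]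
      · intro a ha b hb hab
        simp only [coe_insert, Set.mem_insert_iff, mem_coe] at ha hb
        rcases ha with rfl | ha <;> rcases hb with rfl | hb
        · rfl
        · rw [hfw, hfu b hb] at hab; exact absurd hab.symm (hyU b hb)
        · rw [hfw, hfu a ha] at hab; exact absurd hab (hyU a ha)
        · rw [hfu a ha, hfu b hb] at hab; exact hinj ha hb hab
      · intro a ha b hb hab
        rcases mem_insert.1 ha with rfl | ha1 <;> rcases mem_insert.1 hb with rfl | hb1
        · exact absurd rfl hab.ne
        · rw [hfw, hfu b hb1, ← hedge b hb1 hab]; exact hy.1.symm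
        · rw [hfw, hfu a ha1, ← hedge a ha1 hab.symm]; exact hy.1
        · rw [hfu a ha1, hfu b hb1]; exact hhom a ha1 b hb1 hab
  have hpos : 0 < (univ \ L).card := card_pos.2 ⟨v, by simp [hvL]⟩
  obtain ⟨U, f, hU, hvU, hUc, -, hfv, hinj, hhom⟩ := step ((univ \ L).card - 1) (by omega)
  have hUL : U = univ \ L := eq_of_subset_of_card_le hU (by omega)
  have : Nonempty W := ⟨x⟩
  obtain ⟨g, hg, hgi⟩ := exists_inj_into L
    ((univ.filter (fun y => H.Adj x y)) \ ((U.erase v).image f)) (by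
      have h1 := le_card_sdiff ((U.erase v).image f) (univ.filter (fun y => H.Adj x y))
      have h2 := card_image_le (s := U.erase v) (f := f)
      rw [card_erase_of_mem hvU] at h2
      omega)
  have hgx : ∀ a ∈ L, H.Adj x (g a) := fun a ha =>
    (mem_filter.1 (mem_sdiff.1 (hg a ha)).1).2
  have hgU : ∀ a ∈ L, ∀ u ∈ U, f u ≠ g a := by
    intro a ha u hu h
    by_cases huv : u = v
    · have := hgx a ha
      rw [← h, huv, hfv] at this
      exact this.ne rfl
    · exact (mem_sdiff.1 (hg a ha)).2 (mem_image.2 ⟨u, mem_erase.2 ⟨huv, hu⟩, h⟩)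
  have hmem : ∀ a, a ∉ L → a ∈ U := by intro a ha; rw [hUL]; simp [ha]
  refine ⟨fun a => if a ∈ L then g a else f a, ?_, ?_⟩
  · intro a b hab
    dsimp only at hab
    split_ifs at hab with ha hb hb
    · exact hgi ha hb hab
    · exact absurd hab.symm (hgU a ha b (hmem b hb))
    · exact absurd hab (hgU b hb a (hmem a ha))
    · exact hinj (hmem a ha) (hmem b hb) hab
  · intro a b hab
    dsimp only
    by_cases ha : a ∈ L
    · have hb := hL a ha b hab
      subst hb
      rw [if_pos ha, if_neg hvL, hfv]; exact (hgx a ha).symm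
    · by_cases hb : b ∈ L
      · have ha' := hL b hb a hab.symm
        subst ha'
        rw [if_neg ha, if_pos hb, hfv]; exact hgx b hb
      · rw [if_neg ha, if_neg hb]; exact hhom a (hmem a ha) b (hmem b hb) hab

/-- **Claim 3.1**: if `m ≥ 9`, `n ≥ m² - m + 1`, `T` is a tree on `n` vertices and `G` is a
graph on `2n - 1` vertices containing no `F_m` whose complement contains no `T`, then every
vertex of `T` is adjacent to at most `m - 2` leaves of `T` and `Δ(T) < 11n/20`. -/
theorem tree_few_leaves_and_maxDegree {V W : Type*} [Fintype V] [Fintype W] [DecidableEq V]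
    (m n : ℕ) (hm : 9 ≤ m) (hn : m ^ 2 - m + 1 ≤ n)
    (T : SimpleGraph V) [DecidableRel T.Adj] (hT : T.IsTree) (hTcard : Fintype.card V = n)
    (G : SimpleGraph W) (hGcard : Fintype.card W = 2 * n - 1)
    (hnoF : ¬ Contains G (fan m)) (hnoT : ¬ Contains Gᶜ T) :
    (∀ v : V, ((T.neighborFinset v).filter (fun u => T.degree u = 1)).card ≤ m - 2) ∧
      20 * T.maxDegree < 11 * n := by
  classical
  have hsq : m ^ 2 - m = m * (m - 1) := by rw [Nat.mul_sub, pow_two, mul_one]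
  rw [hsq] at hn
  have hn9 : 9 * m - 8 ≤ n := by
    obtain ⟨M, rfl⟩ : ∃ M, m = M + 1 := ⟨m - 1, by omega⟩
    simp only [Nat.add_sub_cancel] at hn
    nlinarith [show 9 * (M+1) - 8 = 9 * M + 1 by omega]
  have hF : ∀ v, ¬ HM G m (univ.filter (fun y => G.Adj v y)) := fun v h => hnoF (contains_fan v h)
  have hΔ : ∀ v, (univ.filter (fun y => G.Adj v y)).card + 1 ≤ n + m - 1 := by
    intro v
    by_contra hcon
    exact hnoT (tree_in_compl hT m n hm hn9 hTcard _ (by omega) (hF v))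
  have hcompl : ∀ v, (univ.filter (fun y => G.Adj v y)).card +
      (univ.filter (fun y => Gᶜ.Adj v y)).card + 1 = 2 * n - 1 := by
    intro v
    have h1 := card_filter_add_card_filter_not (s := (univ : Finset W)) (fun y => G.Adj v y)
    have h2 : univ.filter (fun y => Gᶜ.Adj v y) = (univ.filter (fun y => ¬ G.Adj v y)).erase v := by
      ext y; simp only [mem_filter, mem_univ, true_and, mem_erase, SimpleGraph.compl_adj, ne_comm]
    have h3 : v ∈ univ.filter (fun y => ¬ G.Adj v y) := by simp
    have h4 := card_erase_add_one h3
    rw [← h2] at h4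
    rw [card_univ, hGcard] at h1
    omega
  obtain ⟨x, hx⟩ : ∃ x, (univ.filter (fun y => G.Adj x y)).card < n := by
    by_contra hcon
    push Not at hcon
    exact star_lemma m n hm hn hGcard hF hcon
  have part1 : ∀ v : V, ((T.neighborFinset v).filter (fun u => T.degree u = 1)).card ≤ m - 2 := by
    intro v
    by_contra hcon
    obtain ⟨L, hLs, hLc⟩ := exists_subset_card_eq
      (s := (T.neighborFinset v).filter (fun u => T.degree u = 1)) (n := m - 1) (by omega)
    have hLm : ∀ l ∈ L, T.Adj v l ∧ T.degree l = 1 := by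
      intro l hl
      have := mem_filter.1 (hLs hl)
      rwa [SimpleGraph.mem_neighborFinset] at this
    refine hnoT (tree_greedy hT (n - m) v x L ?_ ?_ ?_ ?_ ?_)
    · intro l hl w hlw
      obtain ⟨h1, h2⟩ := hLm l hl
      rw [← T.card_neighborFinset_eq_degree, card_eq_one] at h2
      obtain ⟨z, hz⟩ := h2
      have e1 : w ∈ T.neighborFinset l := by rwa [SimpleGraph.mem_neighborFinset]
      have e2 : v ∈ T.neighborFinset l := by rw [SimpleGraph.mem_neighborFinset]; exact h1.symm
      rw [hz, mem_singleton] at e1 e2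
      rw [e1, e2]
    · exact fun h => (hLm v h).1.ne rfl
    · omega
    · intro w
      have := hΔ w
      have := hcompl w
      omega
    · have := hcompl x
      omega
  refine ⟨part1, ?_⟩
  obtain ⟨hpos, hsum⟩ := tree_degree_facts hT (by omega)
  have : Nonempty V := hT.connected.nonempty
  obtain ⟨v, hv⟩ := T.exists_maximal_degree_vertex
  rw [hv]
  have h1 := part1 v
  set d := T.degree v with hd
  have hlow : ∑ w : V, (1 + (if w = v then d - 1 else 0) +
      (if w ∈ (T.neighborFinset v).filter (fun u => ¬ T.degree u = 1) then 1 else 0)) ≤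
      ∑ w, T.degree w := by
    apply sum_le_sum
    intro w _
    have hw := hpos w
    by_cases hwv : w = v
    · subst hwv
      simp
      omega
    · simp only [hwv, if_false]
      split_ifs with h
      · have := (mem_filter.1 h).2
        omega
      · omega
  have hsp := card_filter_add_card_filter_not (s := T.neighborFinset v) (fun u => T.degree u = 1)
  rw [T.card_neighborFinset_eq_degree, ← hd] at hsp
  rw [sum_add_distrib, sum_add_distrib] at hlow
  simp only [sum_const, card_univ, sum_ite_eq', mem_univ, if_true, sum_ite_mem, univ_inter,
    smul_eq_mul, mul_one] at hlow
  have hmm : 10 * m < n + 30 := by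
    obtain ⟨M, rfl⟩ : ∃ M, m = M + 1 := ⟨m - 1, by omega⟩
    simp only [Nat.add_sub_cancel] at hn
    nlinarith
  have := hpos v
  omega
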